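/- Let γ₄(N) = −16·(S_{−3} − S₃ + S_{−2,−1} − S_{−2,1} + S_{−1,−2} − S_{−1,2} − S_{1,−2} + S_{1,2} − S_{2,−1} + S_{2,1} + S_{−1,−1,−1} − S_{−1,−1,1} − S_{1,−1,−1} + S_{1,−1,1})(N) be the four-loop twist-1 ABJM anomalous dimension. Then as m → ∞ along the natural numbers, γ₄(2m) + (4π²/3)·(log(4m) + γ_E) + 12·ζ(3) converges to 0, where ζ(3) = Σ_{n=1}^{∞} 1/n³. In particular the coefficient of log N in the large-spin expansion of γ₄ is −4π²/3, in agreement with the four-loop cusp anomalous dimension. -/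

import Mathlib

/-- Nested (signed) harmonic sum `S_{a₁,…,a_ℓ}(N)`,
`S_{a₁,…,a_ℓ}(N) = Σ_{n=1}^{N} (sign a₁)^n / n^{|a₁|} · S_{a₂,…,a_ℓ}(n)`, with `S_{}(n) = 1`. -/
noncomputable def nestedS : List ℤ → ℕ → ℝ
  | [], _ => 1
  | a :: b, N => ∑ n ∈ Finset.Icc 1 N, ((Int.sign a : ℝ)) ^ n / (n : ℝ) ^ a.natAbs * nestedS b n

/-- Four-loop twist-1 ABJM (asymptotic) anomalous dimension `γ₄^{ABA}(N)`. -/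
noncomputable def gammaFourTwistOne (N : ℕ) : ℝ :=
  (-16 : ℝ) * (nestedS [-3] N - nestedS [3] N + nestedS [-2, -1] N - nestedS [-2, 1] N + nestedS [-1, -2] N - nestedS [-1, 2] N - nestedS [1, -2] N + nestedS [1, 2] N - nestedS [2, -1] N + nestedS [2, 1] N + nestedS [-1, -1, -1] N - nestedS [-1, -1, 1] N - nestedS [1, -1, -1] N + nestedS [1, -1, 1] N)

open Filter Finset Topology

/-- Partial sums `∑_{i<m} 1/(2i+1)^k` of the odd reciprocal powers. -/
noncomputable def oddHarmonic (k m : ℕ) : ℝ := ∑ i ∈ range m, 1 / (2 * (i : ℝ) + 1) ^ k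

lemma oddHarmonic_succ (k m : ℕ) :
    oddHarmonic k (m + 1) = oddHarmonic k m + 1 / (2 * (m : ℝ) + 1) ^ k :=
  sum_range_succ _ _

lemma oddHarmonic_zero (k : ℕ) : oddHarmonic k 0 = 0 := by simp [oddHarmonic]

lemma oddHarmonic_nonneg (k m : ℕ) : 0 ≤ oddHarmonic k m :=
  sum_nonneg fun _ _ => by positivity

lemma oddHarmonic_mono (k : ℕ) : Monotone (oddHarmonic k) :=
  monotone_nat_of_le_succ fun m => by
    rw [oddHarmonic_succ]
    have : 0 ≤ 1 / (2 * (m : ℝ) + 1) ^ k := by positivity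
    linarith

lemma one_le_oddHarmonic (k m : ℕ) : 1 ≤ oddHarmonic k (m + 1) := by
  have h := oddHarmonic_mono k (Nat.succ_le_succ (Nat.zero_le m))
  simpa [oddHarmonic] using h

/-- Partial sums `∑_{i<m} h_{i+1}/(i+1)` where `h` are the odd harmonic numbers. -/
noncomputable def oddHarmonicSum (m : ℕ) : ℝ :=
  ∑ i ∈ range m, oddHarmonic 1 (i + 1) / ((i : ℝ) + 1)

lemma oddHarmonicSum_succ (m : ℕ) :
    oddHarmonicSum (m + 1) = oddHarmonicSum m + oddHarmonic 1 (m + 1) / ((m : ℝ) + 1) :=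
  sum_range_succ _ _

lemma oddHarmonicSum_nonneg (m : ℕ) : 0 ≤ oddHarmonicSum m :=
  sum_nonneg fun i _ => div_nonneg (oddHarmonic_nonneg _ _) (by positivity)

/-! ### Rearrangement of series with nonnegative terms -/

lemma hasSum_of_eq {f g : ℕ → ℝ} {s t : ℝ} (h : HasSum f s) (hfg : ∀ n, g n = f n)
    (hst : t = s) : HasSum g t := by
  rw [hst, funext hfg]
  exact h

lemma hasSum_sum_antidiagonal {f : ℕ → ℕ → ℝ} {r : ℕ → ℝ} {s : ℝ} (hf : ∀ i j, 0 ≤ f i j)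
    (hr : ∀ i, HasSum (f i) (r i)) (hs : HasSum r s) :
    HasSum (fun n => ∑ p ∈ antidiagonal n, f p.1 p.2) s := by
  have hsum : Summable (fun p : ℕ × ℕ => f p.1 p.2) := by
    refine (summable_prod_of_nonneg fun p => hf p.1 p.2).2 ⟨fun i => (hr i).summable, ?_⟩
    simpa only [(hr _).tsum_eq] using hs.summable
  have h1 : HasSum (fun p : ℕ × ℕ => f p.1 p.2) s := by
    have := hsum.hasSum
    have h2 := this.prod_fiberwise hr
    rwa [h2.unique hs] at this
  rw [← (HasAntidiagonal.sigmaAntidiagonalEquivProd (A := ℕ)).hasSum_iff] at h1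
  convert h1.sigma (fun n => hasSum_fintype _) using 2 with n
  exact (sum_coe_sort (antidiagonal n) fun p => f p.1 p.2).symm

/-- Summation by parts against a sequence decreasing to zero. -/
lemma hasSum_partialSum_mul_sub {c v : ℕ → ℝ} {s : ℝ} (hc : ∀ i, 0 ≤ c i) (hv : Antitone v)
    (hv0 : Tendsto v atTop (𝓝 0)) (hs : HasSum (fun i => c i * v i) s) :
    HasSum (fun n => (∑ i ∈ range (n + 1), c i) * (v n - v (n + 1))) s := by
  have hrow : ∀ i, HasSum (fun d => c i * (v (i + d) - v (i + d + 1))) (c i * v i) := by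
    intro i
    refine HasSum.mul_left _ ?_
    rw [hasSum_iff_tendsto_nat_of_nonneg (fun d => sub_nonneg.2 (hv (Nat.le_succ _)))]
    have h1 : ∀ n, ∑ d ∈ range n, (v (i + d) - v (i + d + 1)) = v i - v (i + n) := by
      intro n
      induction n with
      | zero => simp
      | succ n ih => rw [sum_range_succ, ih, ← add_assoc]; ring
    simp only [h1]
    have h2 : Tendsto (fun n => v (i + n)) atTop (𝓝 0) := by
      simpa only [add_comm] using (tendsto_add_atTop_iff_nat i).2 hv0
    simpa using tendsto_const_nhds.sub h2
  have := hasSum_sum_antidiagonal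
    (fun i d => mul_nonneg (hc i) (sub_nonneg.2 (hv (Nat.le_succ _)))) hrow hs
  convert this using 2 with n
  rw [Nat.sum_antidiagonal_eq_sum_range_succ (fun i d => c i * (v (i + d) - v (i + d + 1))),
    sum_mul]
  refine sum_congr rfl fun i hi => ?_
  rw [Nat.add_sub_cancel' (Nat.lt_succ_iff.1 (mem_range.1 hi))]

/-- If `∑ c n * a n` converges with `c` monotone, then `c m` times the tail of `∑ a n` vanishes. -/
lemma tendsto_mul_tail {c a : ℕ → ℝ} {s t : ℝ} (hc : Monotone c) (hc0 : ∀ n, 0 ≤ c n)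
    (ha : ∀ n, 0 ≤ a n) (hs : HasSum a s) (ht : HasSum (fun n => c n * a n) t) :
    Tendsto (fun m => c m * (s - ∑ n ∈ range m, a n)) atTop (𝓝 0) := by
  have h1 : Tendsto (fun m => t - ∑ n ∈ range m, c n * a n) atTop (𝓝 0) := by
    simpa using ht.tendsto_sum_nat.const_sub t
  refine squeeze_zero (fun m => ?_) (fun m => ?_) h1
  · exact mul_nonneg (hc0 m) (sub_nonneg.2 (sum_le_hasSum _ (fun i _ => ha i) hs))
  · have e1 := ((hasSum_nat_add_iff' m).2 hs).mul_left (c m)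
    have e2 := (hasSum_nat_add_iff' m).2 ht
    exact hasSum_le (fun i => mul_le_mul_of_nonneg_right (hc (Nat.le_add_left _ _)) (ha _)) e1 e2

/-! ### Finite convolution identities -/

lemma sum_antidiagonal_fst (f : ℕ → ℝ) (n : ℕ) :
    ∑ p ∈ antidiagonal n, f p.1 = ∑ i ∈ range (n + 1), f i :=
  Nat.sum_antidiagonal_eq_sum_range_succ (fun i _ => f i) n

lemma sum_antidiagonal_snd (f : ℕ → ℝ) (n : ℕ) :
    ∑ p ∈ antidiagonal n, f p.2 = ∑ i ∈ range (n + 1), f i := by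
  rw [← Nat.sum_antidiagonal_swap]
  exact sum_antidiagonal_fst f n

lemma sum_antidiagonal_inv_mul_inv (n : ℕ) :
    ∑ p ∈ antidiagonal n, 1 / ((2 * (p.1 : ℝ) + 1) * (2 * (p.2 : ℝ) + 1))
      = oddHarmonic 1 (n + 1) / ((n : ℝ) + 1) := by
  have h1 : ∀ p ∈ antidiagonal n, 1 / ((2 * (p.1 : ℝ) + 1) * (2 * (p.2 : ℝ) + 1))
      = (1 / (2 * (p.1 : ℝ) + 1) + 1 / (2 * (p.2 : ℝ) + 1)) * (1 / (2 * ((n : ℝ) + 1))) := by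
    intro p hp
    have : (n : ℝ) = p.1 + p.2 := by exact_mod_cast (mem_antidiagonal.1 hp).symm
    rw [this]
    field_simp
    ring
  rw [sum_congr rfl h1, ← sum_mul, sum_add_distrib,
    sum_antidiagonal_fst (fun i => 1 / (2 * (i : ℝ) + 1)),
    sum_antidiagonal_snd (fun i => 1 / (2 * (i : ℝ) + 1))]
  simp only [oddHarmonic, pow_one]
  field_simp
  ring

lemma sum_antidiagonal_oddHarmonic_mul (n : ℕ) :
    ∑ p ∈ antidiagonal n, 1 / (2 * (p.1 : ℝ) + 1) * oddHarmonic 1 (p.2 + 1)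
      = oddHarmonicSum (n + 1) := by
  induction n with
  | zero => simp [oddHarmonicSum]
  | succ n ih =>
    have h1 : ∀ p ∈ antidiagonal n,
        1 / (2 * (p.1 : ℝ) + 1) * oddHarmonic 1 (p.2 + 1 + 1)
          = 1 / (2 * (p.1 : ℝ) + 1) * oddHarmonic 1 (p.2 + 1)
            + 1 / ((2 * (p.1 : ℝ) + 1) * (2 * ((p.2 + 1 : ℕ) : ℝ) + 1)) := by
      intro p _
      rw [oddHarmonic_succ _ (p.2 + 1), pow_one, mul_add, one_div_mul_one_div]
    rw [oddHarmonicSum_succ, ← ih, ← sum_antidiagonal_inv_mul_inv,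
      Nat.sum_antidiagonal_succ', Nat.sum_antidiagonal_succ', sum_congr rfl h1, sum_add_distrib]
    simp [oddHarmonic]
    ring

lemma two_mul_sum_oddHarmonic_div (n : ℕ) :
    2 * ∑ i ∈ range n, oddHarmonic 1 (i + 1) / (2 * (i : ℝ) + 1)
      = oddHarmonic 1 n ^ 2 + oddHarmonic 2 n := by
  induction n with
  | zero => simp [oddHarmonic]
  | succ n ih =>
    rw [sum_range_succ, mul_add, ih, oddHarmonic_succ, oddHarmonic_succ]
    field_simp
    ring

lemma two_mul_sum_oddHarmonic_div_succ (n : ℕ) :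
    2 * ∑ i ∈ range n, oddHarmonic 1 (i + 1) / (2 * (i : ℝ) + 3)
      = oddHarmonic 1 (n + 1) ^ 2 - oddHarmonic 2 (n + 1) := by
  induction n with
  | zero => simp [oddHarmonic]
  | succ n ih =>
    rw [sum_range_succ, mul_add, ih, oddHarmonic_succ _ (n + 1), oddHarmonic_succ _ (n + 1)]
    push_cast
    field_simp
    ring

lemma hasSum_inv_mul_inv (n : ℕ) :
    HasSum (fun i : ℕ => 1 / ((2 * (i : ℝ) + 1) * (2 * (i : ℝ) + 2 * n + 3)))
      (oddHarmonic 1 (n + 1) / (2 * (n : ℝ) + 2)) := by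
  rw [hasSum_iff_tendsto_nat_of_nonneg (fun i => by positivity)]
  have h1 : ∀ m : ℕ, ∑ i ∈ range m, 1 / ((2 * (i : ℝ) + 1) * (2 * (i : ℝ) + 2 * n + 3))
      = (oddHarmonic 1 (n + 1) - ∑ i ∈ range (n + 1), 1 / (2 * ((m : ℝ) + i) + 1))
        / (2 * (n : ℝ) + 2) := by
    intro m
    induction m with
    | zero => simp [oddHarmonic]
    | succ m ih =>
      have h2 : ∑ i ∈ range (n + 1), 1 / (2 * (((m + 1 : ℕ) : ℝ) + i) + 1)
          = ∑ i ∈ range (n + 1), 1 / (2 * ((m : ℝ) + i) + 1) + 1 / (2 * (m : ℝ) + 2 * n + 3)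
            - 1 / (2 * (m : ℝ) + 1) := by
        rw [sum_range_succ, sum_range_succ' _ n]
        have : ∀ i : ℕ, 1 / (2 * (((m + 1 : ℕ) : ℝ) + i) + 1)
            = 1 / (2 * ((m : ℝ) + ((i + 1 : ℕ) : ℝ)) + 1) := by
          intro i; push_cast; ring_nf
        simp only [this]
        push_cast
        ring_nf
      rw [sum_range_succ, ih, h2]
      field_simp
      ring
  simp only [h1]
  have h3 : Tendsto (fun m : ℕ => ∑ i ∈ range (n + 1), 1 / (2 * ((m : ℝ) + i) + 1)) atTop
      (𝓝 (∑ i ∈ range (n + 1), 0)) := by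
    refine tendsto_finsetSum _ fun i _ => ?_
    refine tendsto_const_nhds.div_atTop ?_
    refine tendsto_atTop_add_const_right _ _ (Tendsto.const_mul_atTop two_pos ?_)
    exact tendsto_atTop_add_const_right _ _ tendsto_natCast_atTop_atTop
  simpa using (tendsto_const_nhds.sub h3).div_const (2 * (n : ℝ) + 2)

/-! ### Two evaluations through the substitution `x = tanh t` -/

lemma hasSum_artanh_sq {x t : ℝ} (hx0 : 0 < x) (hx1 : x < 1)
    (ht : Real.log (1 + x) - Real.log (1 - x) = 2 * t) :
    HasSum (fun n : ℕ => oddHarmonic 1 (n + 1) / ((n : ℝ) + 1) * x ^ (2 * n + 2)) (t ^ 2) := by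
  have h1 := (Real.hasSum_log_sub_log_of_abs_lt_one (abs_lt.2 ⟨by linarith, hx1⟩)).div_const 2
  rw [ht, mul_div_cancel_left₀ _ two_ne_zero] at h1
  have h2 := hasSum_sum_antidiagonal (f := fun i j =>
    (2 * (1 / (2 * (i : ℝ) + 1)) * x ^ (2 * i + 1) / 2)
      * (2 * (1 / (2 * (j : ℝ) + 1)) * x ^ (2 * j + 1) / 2))
    (fun i j => by positivity) (fun i => h1.mul_left _) (h1.mul_right t)
  rw [← sq] at h2
  convert h2 using 2 with n
  rw [← sum_antidiagonal_inv_mul_inv, sum_mul]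
  refine sum_congr rfl fun p hp => ?_
  rw [← mem_antidiagonal.1 hp, show 2 * (p.1 + p.2) + 2 = (2 * p.1 + 1) + (2 * p.2 + 1) by ring,
    pow_add]
  field_simp

lemma hasSum_artanh_sq_div {x t : ℝ} (hx0 : 0 < x) (hx1 : x < 1)
    (ht : Real.log (1 + x) - Real.log (1 - x) = 2 * t) :
    HasSum (fun n : ℕ => oddHarmonicSum (n + 1) * x ^ (2 * n + 2)) (t ^ 2 / (1 - x ^ 2)) := by
  have hx2 : x ^ 2 < 1 := by nlinarith
  have h1 := hasSum_geometric_of_lt_one (sq_nonneg x) hx2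
  have h2 := hasSum_artanh_sq hx0 hx1 ht
  have h3 := hasSum_sum_antidiagonal (f := fun i j =>
    (oddHarmonic 1 (i + 1) / ((i : ℝ) + 1) * x ^ (2 * i + 2)) * (x ^ 2) ^ j)
    (fun i j => mul_nonneg (mul_nonneg (div_nonneg (oddHarmonic_nonneg _ _) (by positivity))
      (by positivity)) (by positivity)) (fun i => h1.mul_left _) (h2.mul_right _)
  rw [div_eq_mul_inv]
  convert h3 using 2 with n
  rw [oddHarmonicSum, ← sum_antidiagonal_fst, sum_mul]
  refine sum_congr rfl fun p hp => ?_
  rw [← mem_antidiagonal.1 hp, show 2 * (p.1 + p.2) + 2 = (2 * p.1 + 2) + 2 * p.2 by ring,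
    pow_add, pow_mul x 2 p.2]
  ring

open MeasureTheory ENNReal in
lemma tsum_ofReal_eq_lintegral {s : Set ℝ} (hs : MeasurableSet s) {F : ℕ → ℝ → ℝ} {Φ : ℝ → ℝ}
    {c : ℕ → ℝ} (hm : ∀ n, Measurable (F n)) (h0 : ∀ n, ∀ x ∈ s, 0 ≤ F n x)
    (hF : ∀ x ∈ s, HasSum (fun n => F n x) (Φ x))
    (hc : ∀ n, ∫⁻ x in s, ENNReal.ofReal (F n x) = ENNReal.ofReal (c n)) :
    ∑' n, ENNReal.ofReal (c n) = ∫⁻ x in s, ENNReal.ofReal (Φ x) := by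
  simp only [← hc]
  rw [← lintegral_tsum fun n => (hm n).ennreal_ofReal.aemeasurable]
  refine setLIntegral_congr_fun hs fun x hx => ?_
  rw [← ENNReal.ofReal_tsum_of_nonneg (fun n => h0 n x hx) (hF x hx).summable, (hF x hx).tsum_eq]

lemma hasSum_of_tsum_ofReal_eq {c d : ℕ → ℝ} {s : ℝ} (hc : ∀ n, 0 ≤ c n) (hd : ∀ n, 0 ≤ d n)
    (hs : HasSum d s) (h : ∑' n, ENNReal.ofReal (c n) = ∑' n, ENNReal.ofReal (d n)) :
    HasSum c s := by
  rw [← ENNReal.ofReal_tsum_of_nonneg hd hs.summable, hs.tsum_eq] at h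
  have h1 := ENNReal.hasSum_toReal (h.trans_ne ENNReal.ofReal_ne_top)
  rw [← ENNReal.tsum_toReal_eq (fun _ => ENNReal.ofReal_ne_top), h,
    ENNReal.toReal_ofReal (hs.nonneg hd)] at h1
  simpa only [ENNReal.toReal_ofReal (hc _)] using h1

open MeasureTheory in
lemma lintegral_const_mul_pow {a : ℝ} (ha : 0 ≤ a) (k : ℕ) :
    ∫⁻ x in Set.Ioo (0 : ℝ) 1, ENNReal.ofReal (a * x ^ k)
      = ENNReal.ofReal (a / ((k : ℝ) + 1)) := by
  rw [← ofReal_integral_eq_lintegral_ofReal]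
  · rw [← integral_Ioc_eq_integral_Ioo, ← intervalIntegral.integral_of_le zero_le_one,
      intervalIntegral.integral_const_mul, integral_pow]
    simp [div_eq_mul_inv]
  · exact ((by fun_prop : Continuous fun x : ℝ => a * x ^ k).integrableOn_Icc).mono_set
      Set.Ioo_subset_Icc_self
  · refine (ae_restrict_iff' measurableSet_Ioo).2 (ae_of_all _ fun x hx => ?_)
    have := hx.1
    positivity

open MeasureTheory in
lemma lintegral_sq_mul_exp {r : ℝ} (hr : 0 < r) :
    ∫⁻ t in Set.Ioi (0 : ℝ), ENNReal.ofReal (2 * (t ^ 2 * Real.exp (-(r * t))))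
      = ENNReal.ofReal (4 / r ^ 3) := by
  have h1 := Real.integral_rpow_mul_exp_neg_mul_Ioi (a := 3) (by norm_num) hr
  have h2 : ∀ t : ℝ, t ^ ((3 : ℝ) - 1) = t ^ 2 := fun t => by
    rw [show (3 : ℝ) - 1 = (2 : ℕ) by norm_num, Real.rpow_natCast]
  have h3 : Real.Gamma 3 = 2 := by
    rw [show (3 : ℝ) = (2 : ℕ) + 1 by norm_num, Real.Gamma_nat_eq_factorial]; norm_num
  have h4 : (1 / r) ^ (3 : ℝ) = (1 / r) ^ 3 := by
    rw [show (3 : ℝ) = (3 : ℕ) by norm_num, Real.rpow_natCast]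
  simp only [h2, h3, h4] at h1
  have h5 : Integrable (fun t : ℝ => t ^ 2 * Real.exp (-(r * t)))
      (volume.restrict (Set.Ioi 0)) := by
    refine Integrable.of_integral_ne_zero ?_
    rw [h1]
    positivity
  rw [← ofReal_integral_eq_lintegral_ofReal (h5.const_mul 2) (ae_of_all _ fun t => by positivity),
    integral_const_mul, h1]
  congr 1
  field_simp
  norm_num

/-- `tanh t` expressed through `exp (-2 * t)`. -/
noncomputable def tanhExp (t : ℝ) : ℝ := (1 - Real.exp (-2 * t)) / (1 + Real.exp (-2 * t))

lemma tanhExp_mem {t : ℝ} (ht : 0 < t) : tanhExp t ∈ Set.Ioo (0 : ℝ) 1 := by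
  have h1 : Real.exp (-2 * t) < 1 := Real.exp_lt_one_iff.2 (by linarith)
  have h0 := Real.exp_pos (-2 * t)
  refine ⟨div_pos (by linarith) (by linarith), ?_⟩
  rw [tanhExp, div_lt_one (by linarith)]
  linarith

lemma log_tanhExp (t : ℝ) :
    Real.log (1 + tanhExp t) - Real.log (1 - tanhExp t) = 2 * t := by
  have h0 := Real.exp_pos (-2 * t)
  have e1 : 1 + tanhExp t = 2 / (1 + Real.exp (-2 * t)) := by
    rw [tanhExp]; field_simp; ring
  have e2 : 1 - tanhExp t = 2 / (1 + Real.exp (-2 * t)) * Real.exp (-2 * t) := by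
    rw [tanhExp]; field_simp; ring
  rw [e1, e2, Real.log_mul (by positivity) h0.ne', Real.log_exp]
  ring

lemma image_tanhExp : tanhExp '' Set.Ioi 0 = Set.Ioo 0 1 := by
  refine Set.Subset.antisymm (Set.image_subset_iff.2 fun t ht => tanhExp_mem ht) fun x hx => ?_
  have h1 : 0 < (1 + x) / (1 - x) := div_pos (by linarith [hx.1]) (by linarith [hx.2])
  have h2 : 1 < (1 + x) / (1 - x) := by rw [one_lt_div (by linarith [hx.2])]; linarith [hx.1]
  refine ⟨Real.log ((1 + x) / (1 - x)) / 2, half_pos (Real.log_pos h2), ?_⟩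
  have h3 : Real.exp (-2 * (Real.log ((1 + x) / (1 - x)) / 2)) = (1 - x) / (1 + x) := by
    rw [show -2 * (Real.log ((1 + x) / (1 - x)) / 2) = -Real.log ((1 + x) / (1 - x)) by ring,
      Real.exp_neg, Real.exp_log h1, inv_div]
  have h4 : 1 + x ≠ 0 := by linarith [hx.1]
  rw [tanhExp, h3]
  field_simp
  ring

lemma hasDerivAt_tanhExp (t : ℝ) :
    HasDerivAt tanhExp (4 * Real.exp (-2 * t) / (1 + Real.exp (-2 * t)) ^ 2) t := by
  have h0 := Real.exp_pos (-2 * t)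
  have h1 : HasDerivAt (fun t : ℝ => Real.exp (-2 * t)) (Real.exp (-2 * t) * (-2 * 1)) t :=
    ((hasDerivAt_id t).const_mul (-2)).exp
  refine ((h1.const_sub 1).div (h1.const_add 1) (by positivity)).congr_deriv ?_
  field_simp
  ring

open MeasureTheory in
lemma lintegral_Ioo_eq_lintegral_tanhExp (Φ : ℝ → ℝ) :
    ∫⁻ x in Set.Ioo (0 : ℝ) 1, ENNReal.ofReal (Φ x)
      = ∫⁻ t in Set.Ioi (0 : ℝ), ENNReal.ofReal
        (4 * Real.exp (-2 * t) / (1 + Real.exp (-2 * t)) ^ 2 * Φ (tanhExp t)) := by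
  have hinj : Set.InjOn tanhExp (Set.Ioi 0) := fun s _ t _ h => by
    have := log_tanhExp s
    rw [h, log_tanhExp t] at this
    linarith
  rw [← image_tanhExp, lintegral_image_eq_lintegral_abs_deriv_mul measurableSet_Ioi
    (fun t _ => (hasDerivAt_tanhExp t).hasDerivWithinAt) hinj]
  refine setLIntegral_congr_fun measurableSet_Ioi fun t _ => ?_
  have h0 := Real.exp_pos (-2 * t)
  rw [abs_of_pos (by positivity), ENNReal.ofReal_mul (by positivity)]

/-- If a power series in `x = tanh t` and one in `exp (-2 t)` represent the same density,
their termwise integrals have the same sum. -/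
lemma hasSum_of_artanh_density {F : ℕ → ℝ → ℝ} {Φ : ℝ → ℝ} {c r : ℕ → ℝ} {s : ℝ}
    (hm : ∀ n, Measurable (F n)) (h0 : ∀ n, ∀ x ∈ Set.Ioo (0 : ℝ) 1, 0 ≤ F n x)
    (hF : ∀ x ∈ Set.Ioo (0 : ℝ) 1, HasSum (fun n => F n x) (Φ x))
    (hc : ∀ n, ∫⁻ x in Set.Ioo (0 : ℝ) 1, ENNReal.ofReal (F n x) = ENNReal.ofReal (c n))
    (hc0 : ∀ n, 0 ≤ c n) (hr : ∀ n, 0 < r n)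
    (hexp : ∀ t : ℝ, 0 < t → HasSum (fun n => 2 * (t ^ 2 * Real.exp (-(r n * t))))
      (4 * Real.exp (-2 * t) / (1 + Real.exp (-2 * t)) ^ 2 * Φ (tanhExp t)))
    (hs : HasSum (fun n => 4 / r n ^ 3) s) : HasSum c s := by
  refine hasSum_of_tsum_ofReal_eq hc0 (fun n => by have := hr n; positivity) hs ?_
  rw [tsum_ofReal_eq_lintegral measurableSet_Ioo hm h0 hF hc, lintegral_Ioo_eq_lintegral_tanhExp]
  refine (tsum_ofReal_eq_lintegral measurableSet_Ioi (fun n => by fun_prop)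
    (fun n t _ => by positivity) (fun t ht => hexp t ht) fun n => lintegral_sq_mul_exp (hr n)).symm

lemma hasSum_oddHarmonic_div_sq {s : ℝ}
    (hs : HasSum (fun n : ℕ => 1 / (2 * (n : ℝ) + 1) ^ 3) s) :
    HasSum (fun n : ℕ => oddHarmonic 1 (n + 1) / (2 * (n : ℝ) + 2) ^ 2) (s / 2) := by
  have hh := fun n => oddHarmonic_nonneg 1 (n + 1)
  refine hasSum_of_artanh_density
    (F := fun n x => oddHarmonic 1 (n + 1) / (2 * (n : ℝ) + 2) * x ^ (2 * n + 1))
    (Φ := fun x => ((Real.log (1 + x) - Real.log (1 - x)) / 2) ^ 2 / (2 * x))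
    (r := fun n => 2 * (2 * (n : ℝ) + 1)) (fun n => by fun_prop)
    (fun n x hx => ?_) (fun x hx => ?_) (fun n => ?_) (fun n => ?_) (fun n => by positivity)
    (fun t ht => ?_) ?_
  · have := hh n
    have := hx.1
    positivity
  · have := hx.1
    refine hasSum_of_eq
      ((hasSum_artanh_sq hx.1 hx.2 (mul_div_cancel₀ _ two_ne_zero).symm).div_const (2 * x))
      (fun n => ?_) rfl
    field_simp
    ring
  · rw [lintegral_const_mul_pow (div_nonneg (hh n) (by positivity))]
    congr 1
    push_cast
    field_simp
    ring
  · exact div_nonneg (hh n) (by positivity)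
  · have h0 := Real.exp_pos (-2 * t)
    have h1 : Real.exp (-2 * t) < 1 := Real.exp_lt_one_iff.2 (by linarith)
    have h2 : Real.exp (-2 * t) ^ 2 < 1 := by nlinarith
    have h3 := (hasSum_geometric_of_lt_one (sq_nonneg _) h2).mul_left
      (2 * t ^ 2 * Real.exp (-2 * t))
    refine hasSum_of_eq h3 (fun n => ?_) ?_
    · rw [← pow_mul, ← Real.exp_nat_mul]
      rw [mul_assoc, mul_assoc, ← Real.exp_add]
      push_cast
      ring_nf
    · rw [log_tanhExp, tanhExp]
      have h4 : 1 - Real.exp (-2 * t) ≠ 0 := by linarith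
      have h5 : 1 - Real.exp (-2 * t) ^ 2 = (1 - Real.exp (-2 * t)) * (1 + Real.exp (-2 * t)) := by
        ring
      rw [h5]
      field_simp
      ring
  · refine hasSum_of_eq (hs.div_const 2) (fun n => ?_) rfl
    field_simp
    norm_num

lemma hasSum_oddHarmonicSum_div {s : ℝ}
    (hs : HasSum (fun n : ℕ => 1 / ((n : ℝ) + 1) ^ 3) s) :
    HasSum (fun n : ℕ => oddHarmonicSum (n + 1) / ((2 * (n : ℝ) + 2) * (2 * (n : ℝ) + 3)))
      (s / 2) := by
  have hh := fun n => oddHarmonicSum_nonneg (n + 1)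
  refine hasSum_of_artanh_density
    (F := fun n x => oddHarmonicSum (n + 1) * x ^ (2 * n + 1)
      - oddHarmonicSum (n + 1) * x ^ (2 * n + 2))
    (Φ := fun x => ((Real.log (1 + x) - Real.log (1 - x)) / 2) ^ 2 / (x * (1 + x)))
    (r := fun n => 2 * ((n : ℝ) + 1)) (fun n => by fun_prop)
    (fun n x hx => ?_) (fun x hx => ?_) (fun n => ?_) (fun n => ?_) (fun n => by positivity)
    (fun t ht => ?_) ?_
  · exact sub_nonneg.2 (mul_le_mul_of_nonneg_left
      (pow_le_pow_of_le_one hx.1.le hx.2.le (Nat.le_succ _)) (hh n))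
  · have h1 := hx.1
    have h2 : 1 - x ≠ 0 := by linarith [hx.2]
    have h3 : 1 - x ^ 2 ≠ 0 := by nlinarith [hx.2]
    refine hasSum_of_eq
      ((hasSum_artanh_sq_div hx.1 hx.2 (mul_div_cancel₀ _ two_ne_zero).symm).mul_right
      ((1 - x) / x)) (fun n => ?_) ?_
    · rw [pow_succ x (2 * n + 1)]
      field_simp
    · rw [show 1 - x ^ 2 = (1 - x) * (1 + x) by ring]
      field_simp
  · have hle : ∀ x ∈ Set.Ioo (0 : ℝ) 1, oddHarmonicSum (n + 1) * x ^ (2 * n + 2)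
        ≤ oddHarmonicSum (n + 1) * x ^ (2 * n + 1) := fun x hx => mul_le_mul_of_nonneg_left
      (pow_le_pow_of_le_one hx.1.le hx.2.le (Nat.le_succ _)) (hh n)
    have e1 : ∀ x ∈ Set.Ioo (0 : ℝ) 1,
        ENNReal.ofReal (oddHarmonicSum (n + 1) * x ^ (2 * n + 1)
          - oddHarmonicSum (n + 1) * x ^ (2 * n + 2))
        = ENNReal.ofReal (oddHarmonicSum (n + 1) * x ^ (2 * n + 1))
          - ENNReal.ofReal (oddHarmonicSum (n + 1) * x ^ (2 * n + 2)) := fun x hx =>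
      ENNReal.ofReal_sub _ (mul_nonneg (hh n) (pow_nonneg hx.1.le _))
    rw [MeasureTheory.setLIntegral_congr_fun measurableSet_Ioo e1, MeasureTheory.lintegral_sub,
      lintegral_const_mul_pow (hh n), lintegral_const_mul_pow (hh n), ← ENNReal.ofReal_sub]
    · congr 1
      push_cast
      field_simp
      ring
    · exact div_nonneg (hh n) (by positivity)
    · fun_prop
    · rw [lintegral_const_mul_pow (hh n)]
      exact ENNReal.ofReal_ne_top
    · refine (MeasureTheory.ae_restrict_iff' measurableSet_Ioo).2
        (MeasureTheory.ae_of_all _ fun x hx => ENNReal.ofReal_le_ofReal (hle x hx))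
  · exact div_nonneg (hh n) (by positivity)
  · have h0 := Real.exp_pos (-2 * t)
    have h1 : Real.exp (-2 * t) < 1 := Real.exp_lt_one_iff.2 (by linarith)
    have h3 := (hasSum_geometric_of_lt_one h0.le h1).mul_left
      (2 * t ^ 2 * Real.exp (-2 * t))
    refine hasSum_of_eq h3 (fun n => ?_) ?_
    · rw [← Real.exp_nat_mul]
      rw [mul_assoc, mul_assoc, ← Real.exp_add]
      ring_nf
    · rw [log_tanhExp, tanhExp]
      have h4 : 1 - Real.exp (-2 * t) ≠ 0 := by linarith
      field_simp
      ring
  · refine hasSum_of_eq (hs.div_const 2) (fun n => ?_) rfl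
    field_simp
    norm_num

/-! ### Linear relations between the limiting sums -/

lemma tendsto_one_div_two_mul_add {a : ℝ} :
    Tendsto (fun n : ℕ => 1 / (2 * (n : ℝ) + a)) atTop (𝓝 0) :=
  tendsto_const_nhds.div_atTop (tendsto_atTop_add_const_right _ _
    (Tendsto.const_mul_atTop two_pos tendsto_natCast_atTop_atTop))

lemma antitone_one_div_two_mul_add {a : ℝ} (ha : 0 < a) :
    Antitone (fun n : ℕ => 1 / (2 * (n : ℝ) + a)) := fun m n h => by
  have : (m : ℝ) ≤ n := by exact_mod_cast h
  exact one_div_le_one_div_of_le (by positivity) (by linarith)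

lemma hasSum_one_div_odd_pow {k : ℕ} {s : ℝ}
    (hs : HasSum (fun n : ℕ => 1 / ((n : ℝ) + 1) ^ k) s) :
    HasSum (fun n : ℕ => 1 / (2 * (n : ℝ) + 1) ^ k) ((1 - 1 / 2 ^ k) * s) := by
  have hodd : Summable (fun n : ℕ => 1 / (2 * (n : ℝ) + 1) ^ k) := by
    refine Summable.of_nonneg_of_le (fun n => by positivity) (fun n => ?_) hs.summable
    refine one_div_le_one_div_of_le (by positivity) (pow_le_pow_left₀ (by positivity) ?_ _)
    have : (0 : ℝ) ≤ n := n.cast_nonneg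
    linarith
  have heven : HasSum (fun n : ℕ => 1 / (((2 * n + 1 : ℕ) : ℝ) + 1) ^ k) (1 / 2 ^ k * s) := by
    refine hasSum_of_eq (hs.mul_left (1 / 2 ^ k)) (fun n => ?_) rfl
    rw [one_div_mul_one_div, ← mul_pow]
    push_cast
    ring_nf
  have hodd' : HasSum (fun n : ℕ => 1 / (((2 * n : ℕ) : ℝ) + 1) ^ k)
      (∑' n : ℕ, 1 / (2 * (n : ℝ) + 1) ^ k) := by
    simpa using hodd.hasSum
  have := (HasSum.even_add_odd (f := fun n : ℕ => 1 / ((n : ℝ) + 1) ^ k) hodd' heven).unique hs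
  rw [show (1 - 1 / 2 ^ k) * s = ∑' n : ℕ, 1 / (2 * (n : ℝ) + 1) ^ k by linarith]
  exact hodd.hasSum

lemma hasSum_one_div_odd_sq :
    HasSum (fun n : ℕ => 1 / (2 * (n : ℝ) + 1) ^ 2) (Real.pi ^ 2 / 8) := by
  have h : HasSum (fun n : ℕ => 1 / ((n : ℝ) + 1) ^ 2) (Real.pi ^ 2 / 6) := by
    simpa using (hasSum_nat_add_iff' 1).2 hasSum_zeta_two
  refine hasSum_of_eq (hasSum_one_div_odd_pow h) (fun _ => rfl) ?_
  ring

lemma oddHarmonic_sq_le (n : ℕ) : oddHarmonic 1 n ^ 2 ≤ 2 * oddHarmonicSum n := by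
  have h1 := two_mul_sum_oddHarmonic_div n
  have h2 := oddHarmonic_nonneg 2 n
  have h3 : ∑ i ∈ range n, oddHarmonic 1 (i + 1) / (2 * (i : ℝ) + 1) ≤ oddHarmonicSum n :=
    sum_le_sum fun i _ => div_le_div_of_nonneg_left (oddHarmonic_nonneg _ _) (by positivity)
      (by linarith [(i.cast_nonneg : (0 : ℝ) ≤ i)])
  linarith

lemma oddHarmonic_le_sq (n : ℕ) : oddHarmonic 1 (n + 1) ≤ oddHarmonic 1 (n + 1) ^ 2 :=
  le_self_pow₀ (one_le_oddHarmonic 1 n) two_ne_zero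

lemma oddHarmonic_two_le_sq (n : ℕ) : oddHarmonic 2 (n + 1) ≤ oddHarmonic 1 (n + 1) ^ 2 := by
  have h1 := two_mul_sum_oddHarmonic_div_succ n
  have h2 : 0 ≤ ∑ i ∈ range n, oddHarmonic 1 (i + 1) / (2 * (i : ℝ) + 3) :=
    sum_nonneg fun i _ => div_nonneg (oddHarmonic_nonneg _ _) (by positivity)
  linarith

/-- Any sequence of size `h_n² / n²` is summable. -/
lemma summable_div_of_le_oddHarmonic_sq {b d : ℕ → ℝ} (hb : ∀ n, 0 ≤ b n)
    (hle : ∀ n, b n ≤ oddHarmonic 1 (n + 1) ^ 2)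
    (hd : ∀ n : ℕ, (2 * (n : ℝ) + 2) * (2 * (n : ℝ) + 3) ≤ 6 * d n) :
    Summable fun n => b n / d n := by
  have hz : Summable (fun n : ℕ => 1 / ((n : ℝ) + 1) ^ 3) := by
    have := (summable_nat_add_iff 1).2 (Real.summable_one_div_nat_pow.2 (by norm_num : 1 < 3))
    simpa using this
  have hY := ((hasSum_oddHarmonicSum_div hz.hasSum).summable).mul_left 2
  have hS : Summable fun n : ℕ =>
      oddHarmonic 1 (n + 1) ^ 2 / ((2 * (n : ℝ) + 2) * (2 * (n : ℝ) + 3)) := by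
    refine Summable.of_nonneg_of_le (fun n => by positivity) (fun n => ?_) hY
    rw [← mul_div_assoc]
    gcongr
    exact oddHarmonic_sq_le _
  have hd0 : ∀ n, 0 < d n := fun n => by
    have h1 : 0 < (2 * (n : ℝ) + 2) * (2 * (n : ℝ) + 3) := by positivity
    linarith [hd n]
  refine Summable.of_nonneg_of_le (fun n => div_nonneg (hb n) (hd0 n).le) (fun n => ?_)
    (hS.mul_left 6)
  rw [← mul_div_assoc, div_le_div_iff₀ (hd0 n) (by positivity)]
  calc b n * ((2 * (n : ℝ) + 2) * (2 * (n : ℝ) + 3))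
      ≤ oddHarmonic 1 (n + 1) ^ 2 * (6 * d n) :=
        mul_le_mul (hle n) (hd n) (by positivity) (by positivity)
    _ = _ := by ring

lemma hasSum_oddHarmonic_div :
    HasSum (fun n : ℕ => oddHarmonic 1 (n + 1) / ((2 * (n : ℝ) + 1) * (2 * (n : ℝ) + 2)))
      (Real.pi ^ 2 / 12) := by
  have hP : Summable fun n : ℕ =>
      oddHarmonic 1 (n + 1) / ((2 * (n : ℝ) + 1) * (2 * (n : ℝ) + 2)) :=
    summable_div_of_le_oddHarmonic_sq (fun n => oddHarmonic_nonneg _ _) oddHarmonic_le_sq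
      fun n => by nlinarith [(n.cast_nonneg : (0 : ℝ) ≤ n)]
  obtain ⟨P, hP⟩ := hP
  have hQ := hasSum_sum_antidiagonal (f := fun n i : ℕ =>
    1 / (2 * (n : ℝ) + 1) * (1 / ((2 * (i : ℝ) + 1) * (2 * (i : ℝ) + 2 * n + 3))))
    (fun n i => by positivity) (fun n => (hasSum_inv_mul_inv n).mul_left _)
    (hasSum_of_eq hP (fun n => by field_simp) rfl)
  have hPQ := hasSum_partialSum_mul_sub (c := fun i => 1 / (2 * (i : ℝ) + 1))
    (fun i => by positivity) (antitone_one_div_two_mul_add one_pos) tendsto_one_div_two_mul_add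
    (hasSum_of_eq hasSum_one_div_odd_sq (fun n => by rw [sq, one_div_mul_one_div]) rfl)
  have hQ' : HasSum (fun n : ℕ => oddHarmonic 1 (n + 1) / ((2 * (n : ℝ) + 2) * (2 * (n : ℝ) + 3)))
      (P / 2) := by
    refine hasSum_of_eq (hQ.div_const 2) (fun n => ?_) rfl
    have h1 : ∀ p ∈ antidiagonal n, 1 / (2 * (p.1 : ℝ) + 1)
        * (1 / ((2 * (p.2 : ℝ) + 1) * (2 * (p.2 : ℝ) + 2 * p.1 + 3)))
        = 1 / ((2 * (p.1 : ℝ) + 1) * (2 * (p.2 : ℝ) + 1)) * (1 / (2 * (n : ℝ) + 3)) := by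
      intro p hp
      rw [← mem_antidiagonal.1 hp]
      push_cast
      field_simp
      ring
    rw [sum_congr rfl h1, ← sum_mul, sum_antidiagonal_inv_mul_inv]
    field_simp
  have hPQ' : HasSum (fun n : ℕ =>
      oddHarmonic 1 (n + 1) / ((2 * (n : ℝ) + 1) * (2 * (n : ℝ) + 2))
        + oddHarmonic 1 (n + 1) / ((2 * (n : ℝ) + 2) * (2 * (n : ℝ) + 3))) (Real.pi ^ 2 / 8) := by
    refine hasSum_of_eq hPQ (fun n => ?_) rfl
    simp only [oddHarmonic, pow_one]
    push_cast
    field_simp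
    ring
  have := (hP.add hQ').unique hPQ'
  rwa [show Real.pi ^ 2 / 12 = P by linarith]

lemma sum_antidiagonal_oddHarmonic_div (N : ℕ) :
    ∑ p ∈ antidiagonal N, oddHarmonic 1 (p.1 + 1) / (2 * (p.1 : ℝ) + 1)
        * (1 / ((2 * (p.2 : ℝ) + 1) * (2 * (p.2 : ℝ) + 2 * p.1 + 3)))
      = (oddHarmonicSum (N + 1) + (oddHarmonic 1 (N + 1) ^ 2 + oddHarmonic 2 (N + 1)) / 2)
        / ((2 * (N : ℝ) + 2) * (2 * (N : ℝ) + 3)) := by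
  have h1 : ∀ p ∈ antidiagonal N, oddHarmonic 1 (p.1 + 1) / (2 * (p.1 : ℝ) + 1)
        * (1 / ((2 * (p.2 : ℝ) + 1) * (2 * (p.2 : ℝ) + 2 * p.1 + 3)))
      = (1 / (2 * (p.2 : ℝ) + 1) * oddHarmonic 1 (p.1 + 1)
        + oddHarmonic 1 (p.1 + 1) / (2 * (p.1 : ℝ) + 1))
          * (1 / ((2 * (N : ℝ) + 2) * (2 * (N : ℝ) + 3))) := by
    intro p hp
    rw [← mem_antidiagonal.1 hp]
    push_cast
    have : 2 * (p.2 : ℝ) + 2 * p.1 + 3 = 2 * ((p.1 : ℝ) + p.2) + 3 := by ring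
    rw [this]
    field_simp
    ring
  rw [sum_congr rfl h1, ← sum_mul, sum_add_distrib,
    sum_antidiagonal_fst (fun i => oddHarmonic 1 (i + 1) / (2 * (i : ℝ) + 1)),
    ← two_mul_sum_oddHarmonic_div, ← sum_antidiagonal_oddHarmonic_mul,
    ← Nat.sum_antidiagonal_swap (n := N)]
  simp only [Prod.fst_swap, Prod.snd_swap]
  ring

lemma sum_antidiagonal_oddHarmonic_div_succ (N : ℕ) :
    ∑ p ∈ antidiagonal N, oddHarmonic 1 (p.1 + 1) / (2 * (p.1 : ℝ) + 3)
        * (1 / ((2 * (p.2 : ℝ) + 1) * (2 * (p.2 : ℝ) + 2 * p.1 + 3)))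
      = (oddHarmonicSum (N + 1) + (oddHarmonic 1 (N + 2) ^ 2 - oddHarmonic 2 (N + 2)) / 2)
        / ((2 * (N : ℝ) + 3) * (2 * (N : ℝ) + 4)) := by
  have h1 : ∀ p ∈ antidiagonal N, oddHarmonic 1 (p.1 + 1) / (2 * (p.1 : ℝ) + 3)
        * (1 / ((2 * (p.2 : ℝ) + 1) * (2 * (p.2 : ℝ) + 2 * p.1 + 3)))
      = (1 / (2 * (p.2 : ℝ) + 1) * oddHarmonic 1 (p.1 + 1)
        + oddHarmonic 1 (p.1 + 1) / (2 * (p.1 : ℝ) + 3))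
          * (1 / ((2 * (N : ℝ) + 3) * (2 * (N : ℝ) + 4))) := by
    intro p hp
    rw [← mem_antidiagonal.1 hp]
    push_cast
    have : 2 * (p.2 : ℝ) + 2 * p.1 + 3 = 2 * ((p.1 : ℝ) + p.2) + 3 := by ring
    rw [this]
    field_simp
    ring
  rw [sum_congr rfl h1, ← sum_mul, sum_add_distrib,
    sum_antidiagonal_fst (fun i => oddHarmonic 1 (i + 1) / (2 * (i : ℝ) + 3)),
    ← two_mul_sum_oddHarmonic_div_succ, ← sum_antidiagonal_oddHarmonic_mul,
    ← Nat.sum_antidiagonal_swap (n := N)]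
  simp only [Prod.fst_swap, Prod.snd_swap]
  ring

lemma hasSum_oddHarmonic_sq_div_sub {z : ℝ}
    (hz : HasSum (fun n : ℕ => 1 / ((n : ℝ) + 1) ^ 3) z) :
    HasSum (fun n : ℕ => oddHarmonic 1 (n + 1) ^ 2 / ((2 * (n : ℝ) + 1) * (2 * (n : ℝ) + 2))
      - oddHarmonic 1 (n + 1) / (2 * (n : ℝ) + 1) ^ 2) (-z / 4) := by
  have ho : HasSum (fun n : ℕ => 1 / (2 * (n : ℝ) + 1) ^ 3) (7 / 8 * z) :=
    hasSum_of_eq (hasSum_one_div_odd_pow hz) (fun _ => rfl) (by ring)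
  have hE := hasSum_oddHarmonic_div_sq ho
  have hY := hasSum_oddHarmonicSum_div hz
  have hcast : ∀ n : ℕ, (0 : ℝ) ≤ n := fun n => n.cast_nonneg
  have hsq : ∀ n, 0 ≤ oddHarmonic 1 (n + 1) ^ 2 := fun n => sq_nonneg _
  have hd1 : ∀ n : ℕ, (2 * (n : ℝ) + 2) * (2 * (n : ℝ) + 3)
      ≤ 6 * ((2 * (n : ℝ) + 1) * (2 * (n : ℝ) + 2)) := fun n => by nlinarith [hcast n]
  have hd2 : ∀ n : ℕ, (2 * (n : ℝ) + 2) * (2 * (n : ℝ) + 3)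
      ≤ 6 * ((2 * (n : ℝ) + 2) * (2 * (n : ℝ) + 3)) := fun n => by nlinarith [hcast n]
  have hd3 : ∀ n : ℕ, (2 * (n : ℝ) + 2) * (2 * (n : ℝ) + 3) ≤ 6 * (2 * (n : ℝ) + 1) ^ 2 :=
    fun n => by nlinarith [hcast n]
  obtain ⟨R, hR⟩ := summable_div_of_le_oddHarmonic_sq hsq (fun _ => le_rfl) hd1
  obtain ⟨S, hS⟩ := summable_div_of_le_oddHarmonic_sq hsq (fun _ => le_rfl) hd2
  obtain ⟨U, hU⟩ := summable_div_of_le_oddHarmonic_sq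
    (fun n => oddHarmonic_nonneg 1 (n + 1)) oddHarmonic_le_sq hd3
  obtain ⟨Z', hZ'⟩ := summable_div_of_le_oddHarmonic_sq
    (fun n => oddHarmonic_nonneg 2 (n + 1)) oddHarmonic_two_le_sq hd1
  obtain ⟨Z, hZ⟩ := summable_div_of_le_oddHarmonic_sq
    (fun n => oddHarmonic_nonneg 2 (n + 1)) oddHarmonic_two_le_sq hd2
  have hZZ : Z' + Z = 7 / 8 * z := by
    have h := hasSum_partialSum_mul_sub (c := fun i => 1 / (2 * (i : ℝ) + 1) ^ 2)
      (fun i => by positivity) (antitone_one_div_two_mul_add one_pos) tendsto_one_div_two_mul_add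
      (hasSum_of_eq ho (fun n => by field_simp) rfl)
    refine (hZ'.add hZ).unique (hasSum_of_eq h (fun n => ?_) rfl)
    simp only [oddHarmonic]
    push_cast
    field_simp
    ring
  have hRS : R + S = 2 * U - 7 / 8 * z := by
    have hc : ∀ i : ℕ, oddHarmonic 1 (i + 1) ^ 2 - oddHarmonic 1 i ^ 2
        = 2 * (oddHarmonic 1 (i + 1) / (2 * (i : ℝ) + 1)) - 1 / (2 * (i : ℝ) + 1) ^ 2 := by
      intro i
      rw [oddHarmonic_succ]
      field_simp
      ring
    have h := hasSum_partialSum_mul_sub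
      (c := fun i => oddHarmonic 1 (i + 1) ^ 2 - oddHarmonic 1 i ^ 2)
      (fun i => sub_nonneg.2 (pow_le_pow_left₀ (oddHarmonic_nonneg _ _)
        (oddHarmonic_mono 1 (Nat.le_succ i)) 2))
      (antitone_one_div_two_mul_add one_pos) tendsto_one_div_two_mul_add
      (hasSum_of_eq ((hU.mul_left 2).sub ho) (fun n => by
        rw [hc]
        field_simp) rfl)
    refine (hR.add hS).unique (hasSum_of_eq h (fun n => ?_) rfl)
    rw [sum_range_sub (fun i => oddHarmonic 1 i ^ 2), oddHarmonic_zero]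
    push_cast
    field_simp
    ring
  obtain ⟨Y', hY'⟩ : ∃ Y', Y' = 7 / 8 * z - z / 2 := ⟨_, rfl⟩
  have hYY : HasSum (fun n : ℕ =>
      oddHarmonicSum (n + 1) / ((2 * (n : ℝ) + 3) * (2 * (n : ℝ) + 4))) Y' := by
    have h := hasSum_partialSum_mul_sub (c := fun i => oddHarmonic 1 (i + 1) / ((i : ℝ) + 1))
      (fun i => div_nonneg (oddHarmonic_nonneg _ _) (by positivity))
      (antitone_one_div_two_mul_add two_pos) tendsto_one_div_two_mul_add
      (hasSum_of_eq (hE.mul_left 2) (fun n => by field_simp) rfl)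
    refine hasSum_of_eq (h.sub hY) (fun n => ?_) (by rw [hY']; ring)
    rw [oddHarmonicSum]
    push_cast
    field_simp
    ring
  have hR' : R = z / 2 + (S + Z) / 2 := by
    have h := hasSum_sum_antidiagonal
      (f := fun n i : ℕ => oddHarmonic 1 (n + 1) / (2 * (n : ℝ) + 1)
        * (1 / ((2 * (i : ℝ) + 1) * (2 * (i : ℝ) + 2 * n + 3))))
      (fun n i => mul_nonneg (div_nonneg (oddHarmonic_nonneg _ _) (by positivity))
        (by positivity)) (fun n => (hasSum_inv_mul_inv n).mul_left _)
      (hasSum_of_eq hR (fun n => by field_simp) rfl)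
    refine h.unique (hasSum_of_eq (hY.add ((hS.add hZ).div_const 2)) (fun n => ?_) rfl)
    rw [sum_antidiagonal_oddHarmonic_div]
    ring
  have hS' : S = Y' + (R - Z') / 2 := by
    have h := hasSum_sum_antidiagonal
      (f := fun n i : ℕ => oddHarmonic 1 (n + 1) / (2 * (n : ℝ) + 3)
        * (1 / ((2 * (i : ℝ) + 1) * (2 * (i : ℝ) + 2 * n + 3))))
      (fun n i => mul_nonneg (div_nonneg (oddHarmonic_nonneg _ _) (by positivity))
        (by positivity)) (fun n => (hasSum_inv_mul_inv n).mul_left _)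
      (hasSum_of_eq hS (fun n => by field_simp) rfl)
    have h1 := (hasSum_nat_add_iff' 1).2 ((hR.sub hZ').div_const 2)
    refine h.unique (hasSum_of_eq (hYY.add h1) (fun n => ?_) (by simp [oddHarmonic]))
    rw [sum_antidiagonal_oddHarmonic_div_succ]
    push_cast
    field_simp
    ring
  refine hasSum_of_eq (hR.sub hU) (fun _ => rfl) ?_
  linarith

lemma nestedS_nil (n : ℕ) : nestedS [] n = 1 := by rw [nestedS]

lemma nestedS_succ (a : ℤ) (b : List ℤ) (N : ℕ) :
    nestedS (a :: b) (N + 1) = nestedS (a :: b) N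
      + (Int.sign a : ℝ) ^ (N + 1) / ((N : ℝ) + 1) ^ a.natAbs * nestedS b (N + 1) := by
  simp [nestedS, sum_Icc_succ_top]

lemma nestedS_neg_sub_two_mul {k : ℕ} (hk : k ≠ 0) (m : ℕ) :
    nestedS [-(k : ℤ)] (2 * m) - nestedS [(k : ℤ)] (2 * m) = -2 * oddHarmonic k m := by
  have hs : Int.sign (k : ℤ) = 1 := Int.sign_eq_one_of_pos (by omega)
  induction m with
  | zero => simp [nestedS, oddHarmonic]
  | succ m ih =>
    rw [show 2 * (m + 1) = 2 * m + 1 + 1 by ring, oddHarmonic_succ]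
    simp only [nestedS_succ, Int.sign_neg, hs, Int.natAbs_neg, Int.natAbs_natCast, nestedS_nil]
    push_cast
    simp only [pow_succ (-1 : ℝ), pow_mul (-1 : ℝ), one_pow]
    linear_combination ih

lemma nestedS_neg_one_sub_two_mul (m : ℕ) :
    nestedS [-1] (2 * m) = nestedS [1] (2 * m) - 2 * oddHarmonic 1 m := by
  have h := nestedS_neg_sub_two_mul one_ne_zero m
  rw [Nat.cast_one] at h
  linarith

lemma nestedS_neg_two_sub_two_mul (m : ℕ) :
    nestedS [-2] (2 * m) = nestedS [2] (2 * m) - 2 * oddHarmonic 2 m := by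
  have h := nestedS_neg_sub_two_mul two_ne_zero m
  rw [Nat.cast_ofNat] at h
  linarith

lemma nestedS_neg_one_neg_one_sub (m : ℕ) :
    nestedS [-1, -1] (2 * m) = nestedS [-1, 1] (2 * m)
      + 2 * ∑ n ∈ range m, oddHarmonic 1 (n + 1) / ((2 * (n : ℝ) + 1) * (2 * (n : ℝ) + 2)) := by
  induction m with
  | zero => simp [nestedS]
  | succ m ih =>
    rw [sum_range_succ, show 2 * (m + 1) = 2 * m + 1 + 1 by ring]
    simp only [nestedS_succ, ih, nestedS_neg_one_sub_two_mul, oddHarmonic_succ]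
    simp only [nestedS_nil, Int.sign_neg, Int.sign_one, Int.natAbs_neg, Int.natAbs_one]
    push_cast
    simp only [pow_succ (-1 : ℝ), pow_mul (-1 : ℝ), one_pow]
    field_simp
    ring

lemma gammaFourTwistOne_two_mul (m : ℕ) :
    gammaFourTwistOne (2 * m) = -16 * (2 * oddHarmonic 3 m + 4 * oddHarmonic 1 m * oddHarmonic 2 m
      - 4 * oddHarmonic 1 m
        * ∑ n ∈ range m, oddHarmonic 1 (n + 1) / ((2 * (n : ℝ) + 1) * (2 * (n : ℝ) + 2))
      + 4 * ∑ n ∈ range m, (oddHarmonic 1 (n + 1) ^ 2 / ((2 * (n : ℝ) + 1) * (2 * (n : ℝ) + 2))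
        - oddHarmonic 1 (n + 1) / (2 * (n : ℝ) + 1) ^ 2)) := by
  induction m with
  | zero => simp [gammaFourTwistOne, nestedS, oddHarmonic]
  | succ m ih =>
    rw [sum_range_succ, sum_range_succ]
    rw [gammaFourTwistOne] at ih ⊢
    have e2 : Int.natAbs 2 = 2 := rfl
    have e3 : Int.natAbs 3 = 3 := rfl
    have s2 : Int.sign 2 = 1 := rfl
    have s3 : Int.sign 3 = 1 := rfl
    rw [show 2 * (m + 1) = 2 * m + 1 + 1 by ring]
    simp only [nestedS_succ, nestedS_neg_one_neg_one_sub, nestedS_neg_one_sub_two_mul,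
      nestedS_neg_two_sub_two_mul, oddHarmonic_succ] at ih ⊢
    simp only [nestedS_nil, Int.sign_neg, Int.sign_one,
      Int.natAbs_neg, Int.natAbs_one, e2, e3, s2, s3]
    push_cast
    simp only [pow_succ (-1 : ℝ), pow_mul (-1 : ℝ), one_pow]
    generalize ∑ n ∈ range m,
      oddHarmonic 1 (n + 1) / ((2 * (n : ℝ) + 1) * (2 * (n : ℝ) + 2)) = P at *
    have hx : (2 * (m : ℝ) + 1) ≠ 0 := by positivity
    rw [show 2 * (m : ℝ) + 1 + 1 = 2 * (m + 1) by ring, show 2 * (m : ℝ) + 2 = 2 * (m + 1) by ring]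
    linear_combination (norm := skip) ih
    field_simp
    ring

lemma oddHarmonic_one_eq_harmonic (m : ℕ) :
    oddHarmonic 1 m = (harmonic (2 * m) : ℝ) - harmonic m / 2 := by
  induction m with
  | zero => simp [oddHarmonic]
  | succ m ih =>
    rw [oddHarmonic_succ, ih, show 2 * (m + 1) = 2 * m + 1 + 1 by ring]
    simp only [harmonic_succ]
    push_cast
    field_simp
    ring

lemma tendsto_oddHarmonic_one_sub_log :
    Tendsto (fun m : ℕ => oddHarmonic 1 m
      - (Real.log (4 * (m : ℝ)) + Real.eulerMascheroniConstant) / 2) atTop (𝓝 0) := by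
  have h := Real.tendsto_harmonic_sub_log
  have h2 : Tendsto (fun m : ℕ => 2 * m) atTop atTop := tendsto_id.const_mul_atTop' two_pos
  have h3 := ((h.comp h2).sub (h.div_const 2)).sub_const (Real.eulerMascheroniConstant / 2)
  rw [show Real.eulerMascheroniConstant - Real.eulerMascheroniConstant / 2
    - Real.eulerMascheroniConstant / 2 = 0 by ring] at h3
  refine h3.congr' ?_
  filter_upwards [eventually_ne_atTop 0] with m hm
  have hm' : (m : ℝ) ≠ 0 := Nat.cast_ne_zero.2 hm
  rw [oddHarmonic_one_eq_harmonic, Real.log_mul (by norm_num) hm',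
    show (4 : ℝ) = 2 ^ 2 by norm_num, Real.log_pow]
  simp only [Function.comp_apply]
  push_cast
  rw [Real.log_mul two_ne_zero hm']
  ring

lemma tendsto_oddHarmonic_mul_tail {d b : ℕ → ℝ} {s : ℝ} (hb : ∀ n, 0 ≤ b n)
    (hle : ∀ n, b n ≤ oddHarmonic 1 (n + 1))
    (hd : ∀ n : ℕ, (2 * (n : ℝ) + 2) * (2 * n + 3) ≤ 6 * d n)
    (hs : HasSum (fun n => b n / d n) s) :
    Tendsto (fun m => oddHarmonic 1 m * (s - ∑ n ∈ range m, b n / d n)) atTop (𝓝 0) := by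
  have hd0 : ∀ n, 0 ≤ d n := fun n => by
    have := hd n
    have : (0 : ℝ) ≤ (2 * (n : ℝ) + 2) * (2 * n + 3) := by positivity
    linarith
  have hsum : Summable fun n => oddHarmonic 1 n * b n / d n :=
    summable_div_of_le_oddHarmonic_sq (fun n => mul_nonneg (oddHarmonic_nonneg _ _) (hb n))
      (fun n => by
        rw [sq]
        exact mul_le_mul (oddHarmonic_mono 1 n.le_succ) (hle n) (hb n) (oddHarmonic_nonneg _ _)) hd
  exact tendsto_mul_tail (oddHarmonic_mono 1) (oddHarmonic_nonneg 1)
    (fun n => div_nonneg (hb n) (hd0 n)) hs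
    (hasSum_of_eq hsum.hasSum (fun n => by rw [mul_div_assoc]) rfl)

/-- Logarithmic scaling of the four-loop twist-1 ABJM anomalous dimension:
as `m → ∞`, `γ₄(2m) + (4π²/3)·(log(4m) + γ_E) + 12·ζ(3) → 0`, where
`ζ(3) = Σ_{n=1}^{∞} 1/n³`. -/
theorem twist1_four_loop_logarithmic_scaling :
    Filter.Tendsto (fun m : ℕ =>
        gammaFourTwistOne (2 * m)
          + (4 * Real.pi ^ 2 / 3) * (Real.log (4 * (m : ℝ)) + Real.eulerMascheroniConstant)
          + 12 * (∑' n : ℕ, 1 / ((n : ℝ) + 1) ^ 3))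
      Filter.atTop (nhds 0) := by
  have hsum : Summable fun n : ℕ => 1 / ((n : ℝ) + 1) ^ 3 := by
    simpa using (summable_nat_add_iff 1).2 (Real.summable_one_div_nat_pow.2 (by norm_num : 1 < 3))
  have hz := hsum.hasSum
  generalize ∑' n : ℕ, 1 / ((n : ℝ) + 1) ^ 3 = z at hz ⊢
  have hO3 : Tendsto (oddHarmonic 3) atTop (𝓝 ((1 - 1 / 2 ^ 3) * z)) :=
    (hasSum_one_div_odd_pow hz).tendsto_sum_nat
  have hB := (hasSum_oddHarmonic_sq_div_sub hz).tendsto_sum_nat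
  have hP := tendsto_oddHarmonic_mul_tail (fun n => oddHarmonic_nonneg 1 (n + 1))
    (fun n => le_rfl) (fun n => by nlinarith [(n.cast_nonneg : (0 : ℝ) ≤ n)])
    hasSum_oddHarmonic_div
  have hO2 := tendsto_oddHarmonic_mul_tail (fun n => zero_le_one)
    (fun n => one_le_oddHarmonic 1 n) (fun n => by nlinarith [(n.cast_nonneg : (0 : ℝ) ≤ n)])
    hasSum_one_div_odd_sq
  have h := ((((hO3.const_mul (-32)).add (hB.const_mul (-64))).add
    ((hO2.sub hP).const_mul 64)).add
    (tendsto_oddHarmonic_one_sub_log.const_mul (-(8 * Real.pi ^ 2 / 3)))).add_const (12 * z)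
  convert h using 2 with m
  · simp only [gammaFourTwistOne_two_mul, oddHarmonic]
    ring
  · ring
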